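/- arXiv:2109.02530 — 7 statements merged into one kernel-verified Lean document; each statement's English description precedes it below -/
import Mathlib

section
/- Let q be a C¹ solution of the one-dimensional generalized advection equation ∂ₜq + v ∂ₓq + b q = 0 on the circle, and suppose there is a constant C ≥ 0 with |2 b(t,x) − ∂ₓv(t,x)| ≤ C for all (t,x). Then for all t ≥ 0, ∫₀^{2π} q(t,x)² dx ≤ e^{C t} ∫₀^{2π} q(0,x)² dx; in particular, if q(0,·) is identically zero then q(t,·) is identically zero for all t ≥ 0. -/
open Real intervalIntegral

lemma aux_dt (q : ℝ → ℝ → ℝ) (hq : ContDiff ℝ 1 (Function.uncurry q)) (t x : ℝ) :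
    HasDerivAt (fun τ => q τ x) (fderiv ℝ (Function.uncurry q) (t, x) (1, 0)) t := by
  have h := (hq.differentiable one_ne_zero (t, x)).hasFDerivAt
  have h2 : HasDerivAt (fun τ : ℝ => (τ, x)) ((1 : ℝ), (0 : ℝ)) t :=
    (hasDerivAt_id t).prodMk (hasDerivAt_const t x)
  exact h.comp_hasDerivAt t h2

lemma aux_dx (q : ℝ → ℝ → ℝ) (hq : ContDiff ℝ 1 (Function.uncurry q)) (t x : ℝ) :
    HasDerivAt (fun y => q t y) (fderiv ℝ (Function.uncurry q) (t, x) (0, 1)) x := by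
  have h := (hq.differentiable one_ne_zero (t, x)).hasFDerivAt
  have h2 : HasDerivAt (fun y : ℝ => (t, y)) ((0 : ℝ), (1 : ℝ)) x :=
    (hasDerivAt_const x t).prodMk (hasDerivAt_id x)
  exact h.comp_hasDerivAt x h2

lemma aux_E (q : ℝ → ℝ → ℝ) (hq : ContDiff ℝ 1 (Function.uncurry q)) (t : ℝ) :
    HasDerivAt (fun s => ∫ x in (0 : ℝ)..(2 * π), (q s x) ^ 2)
      (∫ x in (0 : ℝ)..(2 * π), 2 * q t x * fderiv ℝ (Function.uncurry q) (t, x) (1, 0)) t := by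
  have hqc : Continuous (Function.uncurry q) := hq.continuous
  have hfc : Continuous (fun p : ℝ × ℝ => fderiv ℝ (Function.uncurry q) p (1, 0)) :=
    (hq.continuous_fderiv one_ne_zero).clm_apply continuous_const
  have hF : Continuous (fun p : ℝ × ℝ =>
      2 * Function.uncurry q p * fderiv ℝ (Function.uncurry q) p (1, 0)) :=
    (continuous_const.mul hqc).mul hfc
  have hsl : ∀ s, Continuous (fun x => q s x) := fun s =>
    hqc.comp (by fun_prop : Continuous fun x : ℝ => (s, x))
  obtain ⟨M, hM⟩ := ((isCompact_Icc (a := t - 1) (b := t + 1)).prod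
    (isCompact_uIcc (a := (0 : ℝ)) (b := 2 * π))).exists_bound_of_continuousOn hF.continuousOn
  refine (intervalIntegral.hasDerivAt_integral_of_dominated_loc_of_deriv_le
    (F := fun s x => (q s x) ^ 2)
    (F' := fun s x => 2 * q s x * fderiv ℝ (Function.uncurry q) (s, x) (1, 0))
    (bound := fun _ => M) (s := Set.Icc (t - 1) (t + 1))
    (Icc_mem_nhds (by linarith) (by linarith)) ?_ ?_ ?_ ?_ ?_ ?_).2
  · exact Filter.Eventually.of_forall fun s => ((hsl s).pow 2).aestronglyMeasurable
  · exact ((hsl t).pow 2).intervalIntegrable _ _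
  · exact (hF.comp (by fun_prop : Continuous fun x : ℝ => (t, x))).aestronglyMeasurable
  · refine Filter.Eventually.of_forall fun x hx s hs => ?_
    exact hM (s, x) ⟨hs, Set.uIoc_subset_uIcc hx⟩
  · exact intervalIntegrable_const
  · refine Filter.Eventually.of_forall fun x hx s hs => ?_
    have := (aux_dt q hq s x).pow 2
    simp only [Nat.cast_ofNat, Nat.add_one_sub_one, pow_one] at this
    exact this

/-- Let `q` be a `C¹` solution of `∂ₜq + v ∂ₓq + b q = 0` on the circle, and suppose
`|2 b − ∂ₓv| ≤ C` everywhere for some constant `C ≥ 0`.  Then for all `t ≥ 0`,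
`∫₀^{2π} q(t,x)² dx ≤ e^{C t} ∫₀^{2π} q(0,x)² dx`; in particular if `q(0,·) ≡ 0`
then `q(t,·) ≡ 0` for all `t ≥ 0`. -/
theorem energy_estimate_generalized_advection
    (v b q : ℝ → ℝ → ℝ) (C : ℝ) (hC : 0 ≤ C)
    (hv : ∀ t, ContDiff ℝ 1 (v t))
    (hvper : ∀ t x, v t (x + 2 * π) = v t x)
    (hb : Continuous (Function.uncurry b))
    (hbper : ∀ t x, b t (x + 2 * π) = b t x)
    (hbound : ∀ t x, |2 * b t x - deriv (fun y => v t y) x| ≤ C)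
    (hq : ContDiff ℝ 1 (Function.uncurry q))
    (hqper : ∀ t x, q t (x + 2 * π) = q t x)
    (hpde : ∀ t x,
      deriv (fun τ => q τ x) t + v t x * deriv (fun y => q t y) x
        + b t x * q t x = 0) :
    (∀ t, 0 ≤ t →
      (∫ x in (0 : ℝ)..(2 * π), (q t x) ^ 2)
        ≤ Real.exp (C * t) * ∫ x in (0 : ℝ)..(2 * π), (q 0 x) ^ 2) ∧
    ((∀ x, q 0 x = 0) → ∀ t, 0 ≤ t → ∀ x, q t x = 0) := by
  have hpi : (0 : ℝ) < 2 * π := by positivity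
  have hsl : ∀ s, Continuous (fun x => q s x) := fun s =>
    hq.continuous.comp (by fun_prop : Continuous fun x : ℝ => (s, x))
  have hbs : ∀ s, Continuous (fun x => b s x) := fun s =>
    hb.comp (by fun_prop : Continuous fun x : ℝ => (s, x))
  have hvd : ∀ s, Continuous (deriv (fun y => v s y)) := fun s =>
    (hv s).continuous_deriv le_rfl
  have hxs : ∀ s, Continuous (fun x => fderiv ℝ (Function.uncurry q) (s, x) (0, 1)) := fun s =>
    ((hq.continuous_fderiv one_ne_zero).clm_apply continuous_const).comp
      (by fun_prop : Continuous fun x : ℝ => (s, x))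
  have key : ∀ t, (∫ x in (0 : ℝ)..(2 * π),
      2 * q t x * fderiv ℝ (Function.uncurry q) (t, x) (1, 0))
      ≤ C * ∫ x in (0 : ℝ)..(2 * π), (q t x) ^ 2 := by
    intro t
    have hvc : Continuous (fun x => v t x) := (hv t).continuous
    have hq1 := hsl t
    have hb1 := hbs t
    have hv1 := hvd t
    have hx1 := hxs t
    let G : ℝ → ℝ := fun x => deriv (fun y => v t y) x * (q t x) ^ 2
      + v t x * (2 * q t x * fderiv ℝ (Function.uncurry q) (t, x) (0, 1))
    have hGc : Continuous G := by
      exact (hv1.mul (hq1.pow 2)).add (hvc.mul ((continuous_const.mul hq1).mul hx1))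
    have hG0 : ∫ x in (0 : ℝ)..(2 * π), G x = 0 := by
      rw [intervalIntegral.integral_eq_sub_of_hasDerivAt (f := fun x => v t x * (q t x) ^ 2)
        _ (hGc.intervalIntegrable _ _)]
      · have h1 := hvper t 0
        have h2 := hqper t 0
        rw [zero_add] at h1 h2
        simp only [h1, h2, sub_self]
      · intro x _
        have h1 := ((hv t).differentiable one_ne_zero x).hasDerivAt
        have h2 := (aux_dx q hq t x).pow 2
        simp only [Nat.cast_ofNat, Nat.add_one_sub_one, pow_one] at h2
        exact h1.mul h2
    have e1 : ∀ x, 2 * q t x * fderiv ℝ (Function.uncurry q) (t, x) (1, 0)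
        = (deriv (fun y => v t y) x - 2 * b t x) * (q t x) ^ 2 - G x := by
      intro x
      have h := hpde t x
      rw [(aux_dt q hq t x).deriv, (aux_dx q hq t x).deriv] at h
      simp only [G]
      linear_combination 2 * q t x * h
    have hHc : Continuous fun x => (deriv (fun y => v t y) x - 2 * b t x) * (q t x) ^ 2 :=
      (hv1.sub (continuous_const.mul hb1)).mul (hq1.pow 2)
    simp_rw [e1]
    rw [intervalIntegral.integral_sub (hHc.intervalIntegrable _ _) (hGc.intervalIntegrable _ _),
      hG0, sub_zero, ← intervalIntegral.integral_const_mul]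
    refine intervalIntegral.integral_mono_on hpi.le (hHc.intervalIntegrable _ _)
      ((continuous_const.mul (hq1.pow 2)).intervalIntegrable _ _) fun x _ => ?_
    have := (abs_le.1 (hbound t x)).1
    exact mul_le_mul_of_nonneg_right (by linarith) (sq_nonneg _)
  have main : ∀ t, 0 ≤ t →
      (∫ x in (0 : ℝ)..(2 * π), (q t x) ^ 2)
        ≤ Real.exp (C * t) * ∫ x in (0 : ℝ)..(2 * π), (q 0 x) ^ 2 := by
    have hd : ∀ t, HasDerivAt (fun s => Real.exp (-(C * s)) *
        ∫ x in (0 : ℝ)..(2 * π), (q s x) ^ 2) _ t := fun t =>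
      (((hasDerivAt_id t).const_mul C).neg.exp).mul (aux_E q hq t)
    have hanti := antitone_of_deriv_nonpos (fun t => (hd t).differentiableAt) (fun t => by
      rw [(hd t).deriv]
      have := mul_le_mul_of_nonneg_left (key t) (Real.exp_pos (-(C * t))).le
      simp only [id, Pi.neg_apply, mul_one] at *
      linarith)
    intro t ht
    have h := hanti ht
    simp only [mul_zero, neg_zero, Real.exp_zero, one_mul] at h
    have h2 := mul_le_mul_of_nonneg_left h (Real.exp_pos (C * t)).le
    rwa [← mul_assoc, ← Real.exp_add, add_neg_cancel, Real.exp_zero, one_mul] at h2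
  refine ⟨main, fun h0 t ht x => ?_⟩
  have hm := main t ht
  simp only [h0] at hm
  have hper : Function.Periodic (q t) (2 * π) := hqper t
  obtain ⟨y, hy, hxy⟩ := hper.exists_mem_Ico₀ hpi x
  rw [hxy]
  by_contra hne
  have := intervalIntegral.integral_pos hpi ((hsl t).pow 2).continuousOn
    (fun z _ => sq_nonneg _) ⟨y, ⟨hy.1, hy.2.le⟩, sq_pos_of_ne_zero hne⟩
  simp at hm this
  linarith
end

section
/- Suppose d is a C¹ solution of ∂ₜd + v ∂ₓd + (b − (1/2)∂ₓv) d = 0 and u is a C¹ solution of ∂ₜu + v ∂ₓu + (1/2)(∂ₓv) u = 0 on a common domain. Then the product M(t,x) = d(t,x) u(t,x) is a solution of the generalized advection equation ∂ₜM + v ∂ₓM + b M = 0. -/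
open Real

/-- If `d` is a `C¹` solution of `∂ₜd + v ∂ₓd + (b − (1/2)∂ₓv) d = 0` and `u` is a
`C¹` solution of `∂ₜu + v ∂ₓu + (1/2)(∂ₓv) u = 0`, then the product
`M(t,x) = d(t,x) u(t,x)` solves the generalized advection equation
`∂ₜM + v ∂ₓM + b M = 0`. -/
theorem polar_decomposition_kernel_product
    (v b d u : ℝ → ℝ → ℝ)
    (hv : ∀ t, ContDiff ℝ 1 (v t))
    (hb : Continuous (Function.uncurry b))
    (hd : ContDiff ℝ 1 (Function.uncurry d))
    (hu : ContDiff ℝ 1 (Function.uncurry u))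
    (hpded : ∀ t x,
      deriv (fun τ => d τ x) t + v t x * deriv (fun y => d t y) x
        + (b t x - (1 / 2) * deriv (fun y => v t y) x) * d t x = 0)
    (hpdeu : ∀ t x,
      deriv (fun τ => u τ x) t + v t x * deriv (fun y => u t y) x
        + (1 / 2) * deriv (fun y => v t y) x * u t x = 0) :
    ∀ t x,
      deriv (fun τ => d τ x * u τ x) t
        + v t x * deriv (fun y => d t y * u t y) x
        + b t x * (d t x * u t x) = 0 := by
  intro t x
  have key : ∀ f : ℝ → ℝ → ℝ, ContDiff ℝ 1 (Function.uncurry f) →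
      DifferentiableAt ℝ (fun τ => f τ x) t ∧ DifferentiableAt ℝ (fun y => f t y) x := by
    intro f hf
    have h : Differentiable ℝ (Function.uncurry f) := hf.differentiable (by norm_num)
    have h1 : Differentiable ℝ (fun τ : ℝ => (τ, x)) := by fun_prop
    have h2 : Differentiable ℝ (fun y : ℝ => (t, y)) := by fun_prop
    exact ⟨(h.comp h1) t, (h.comp h2) x⟩
  obtain ⟨d1, d2⟩ := key d hd
  obtain ⟨u1, u2⟩ := key u hu
  have e1 := (d1.hasDerivAt.mul u1.hasDerivAt).deriv
  have e2 := (d2.hasDerivAt.mul u2.hasDerivAt).deriv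
  change deriv (fun τ => d τ x * u τ x) t = _ at e1
  change deriv (fun y => d t y * u t y) x = _ at e2
  rw [e1, e2]
  linear_combination u t x * hpded t x + d t x * hpdeu t x
end

section
/- Let σ² be a C¹ solution of the variance equation ∂ₜσ² + v ∂ₓσ² + 2b σ² = 0 and let Pᶜ be a C¹, nowhere-vanishing solution of the continuous spectrum equation ∂ₜPᶜ + v ∂ₓPᶜ + (2b − ∂ₓv) Pᶜ = 0, with the same initial data σ²(0,x) = Pᶜ(0,x) for all x. Then the ratio m(t,x) := σ²(t,x)/Pᶜ(t,x) satisfies the continuity equation ∂ₜm + v ∂ₓm + (∂ₓv) m = 0 with m(0,x) = 1 for all x. -/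
open Real

/-- Let `σ²` be a `C¹` solution of the variance equation
`∂ₜσ² + v ∂ₓσ² + 2b σ² = 0` and `Pᶜ` a `C¹`, nowhere-vanishing solution of the
continuous spectrum equation `∂ₜPᶜ + v ∂ₓPᶜ + (2b − ∂ₓv) Pᶜ = 0`, with the same
initial data.  Then `m := σ²/Pᶜ` solves the continuity equation
`∂ₜm + v ∂ₓm + (∂ₓv) m = 0` with `m(0,·) = 1`. -/
theorem variance_continuous_spectrum_ratio_solves_continuity
    (v b σsq Pc : ℝ → ℝ → ℝ)
    (hv : ∀ t, ContDiff ℝ 1 (v t))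
    (hb : Continuous (Function.uncurry b))
    (hσ : ContDiff ℝ 1 (Function.uncurry σsq))
    (hPc : ContDiff ℝ 1 (Function.uncurry Pc))
    (hPcne : ∀ t x, Pc t x ≠ 0)
    (hpdeσ : ∀ t x,
      deriv (fun τ => σsq τ x) t + v t x * deriv (fun y => σsq t y) x
        + 2 * b t x * σsq t x = 0)
    (hpdePc : ∀ t x,
      deriv (fun τ => Pc τ x) t + v t x * deriv (fun y => Pc t y) x
        + (2 * b t x - deriv (fun y => v t y) x) * Pc t x = 0)
    (hinit : ∀ x, σsq 0 x = Pc 0 x) :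
    (∀ t x,
      deriv (fun τ => σsq τ x / Pc τ x) t
        + v t x * deriv (fun y => σsq t y / Pc t y) x
        + deriv (fun y => v t y) x * (σsq t x / Pc t x) = 0) ∧
    (∀ x, σsq 0 x / Pc 0 x = 1) := by
  refine ⟨fun t x => ?_, fun x => ?_⟩
  · have dt : ∀ f : ℝ → ℝ → ℝ, ContDiff ℝ 1 (Function.uncurry f) →
        DifferentiableAt ℝ (fun τ => f τ x) t := by
      intro f hf
      have h : Differentiable ℝ (Function.uncurry f) := hf.differentiable (by norm_num)
      exact (h.comp (differentiable_id.prodMk (differentiable_const x))) t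
    have dx : ∀ f : ℝ → ℝ → ℝ, ContDiff ℝ 1 (Function.uncurry f) →
        DifferentiableAt ℝ (fun y => f t y) x := by
      intro f hf
      have h : Differentiable ℝ (Function.uncurry f) := hf.differentiable (by norm_num)
      exact (h.comp ((differentiable_const t).prodMk differentiable_id)) x
    have hP := hPcne t x
    have h1 := hpdeσ t x
    have h2 := hpdePc t x
    rw [deriv_fun_div (dt σsq hσ) (dt Pc hPc) hP, deriv_fun_div (dx σsq hσ) (dx Pc hPc) hP]
    generalize deriv (fun τ => σsq τ x) t = a at *
    generalize deriv (fun y => σsq t y) x = c at *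
    generalize deriv (fun τ => Pc τ x) t = d at *
    generalize deriv (fun y => Pc t y) x = e at *
    generalize deriv (fun y => v t y) x = w at *
    field_simp
    linear_combination Pc t x * h1 - σsq t x * h2
  · rw [hinit, div_self (hPcne 0 x)]
end

section
/- Fix s ∈ (−π, π) and let I ⊆ ℝ be an open interval containing 0 such that for all t ∈ I the quantity θ(t) := arctan((2 tan(s/2) + 1)/√3) + (√3/2) t lies in (−π/2, π/2). Define X(t) = 2 arctan((√3 tan(θ(t)) − 1)/2). Then X(0) = s and X satisfies the characteristic ordinary differential equation X′(t) = sin(X(t)) + 2 for all t ∈ I. -/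
open Real

/-- Fix `s ∈ (−π, π)` and an open interval `I ∋ 0` on which
`θ(t) = arctan((2 tan(s/2) + 1)/√3) + (√3/2) t` stays in `(−π/2, π/2)`.
Then `X(t) = 2 arctan((√3 tan(θ(t)) − 1)/2)` satisfies `X(0) = s` and the
characteristic ODE `X′(t) = sin(X(t)) + 2` on `I`. -/
theorem characteristic_ode_solution
    (s : ℝ) (hs : s ∈ Set.Ioo (-π) π)
    (I : Set ℝ) (hI : IsOpen I) (hI0 : (0 : ℝ) ∈ I)
    (hIinterval : ∃ a b' : ℝ, I = Set.Ioo a b')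
    (θ X : ℝ → ℝ)
    (hθ : ∀ t, θ t = arctan ((2 * tan (s / 2) + 1) / Real.sqrt 3)
      + (Real.sqrt 3 / 2) * t)
    (hθI : ∀ t ∈ I, θ t ∈ Set.Ioo (-(π / 2)) (π / 2))
    (hX : ∀ t, X t = 2 * arctan ((Real.sqrt 3 * tan (θ t) - 1) / 2)) :
    X 0 = s ∧ ∀ t ∈ I, HasDerivAt X (Real.sin (X t) + 2) t := by
  have h3 : Real.sqrt 3 * Real.sqrt 3 = 3 := Real.mul_self_sqrt (by norm_num)
  have h3p : 0 < Real.sqrt 3 := Real.sqrt_pos.mpr (by norm_num)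
  constructor
  · rw [hX, hθ, mul_zero, add_zero, Real.tan_arctan]
    have e : (Real.sqrt 3 * ((2 * tan (s / 2) + 1) / Real.sqrt 3) - 1) / 2 = tan (s / 2) := by
      field_simp
      ring
    rw [e, Real.arctan_tan (by linarith [hs.1]) (by linarith [hs.2])]
    ring
  · intro t ht
    have hc : 0 < cos (θ t) := Real.cos_pos_of_mem_Ioo (hθI t ht)
    have hd : HasDerivAt θ (Real.sqrt 3 / 2) t := by
      have := ((hasDerivAt_id t).const_mul (Real.sqrt 3 / 2)).const_add
        (arctan ((2 * tan (s / 2) + 1) / Real.sqrt 3))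
      rw [mul_one] at this
      exact this.congr_of_eventuallyEq (Filter.Eventually.of_forall hθ)
    have hT := (Real.hasDerivAt_tan hc.ne').comp t hd
    have hU := (((hT.const_mul (Real.sqrt 3)).sub_const 1).div_const 2).arctan.const_mul 2
    have hXd := hU.congr_of_eventuallyEq (f₁ := X) (Filter.Eventually.of_forall hX)
    refine hXd.congr_deriv ?_
    simp only [Function.comp]
    rw [hX t, Real.sin_two_mul, Real.sin_arctan, Real.cos_arctan]
    have hcos : 1 / cos (θ t) ^ 2 = 1 + tan (θ t) ^ 2 := by
      rw [← Real.inv_one_add_tan_sq hc.ne']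
      simp
    rw [hcos]
    generalize tan (θ t) = T
    obtain ⟨u, hu⟩ : ∃ u, u = (Real.sqrt 3 * T - 1) / 2 := ⟨_, rfl⟩
    rw [← hu]
    have hp : 0 < 1 + u ^ 2 := by positivity
    have hq : Real.sqrt (1 + u ^ 2) * Real.sqrt (1 + u ^ 2) = 1 + u ^ 2 :=
      Real.mul_self_sqrt hp.le
    have e1 : 2 * (u / Real.sqrt (1 + u ^ 2)) * (1 / Real.sqrt (1 + u ^ 2))
        = 2 * u / (1 + u ^ 2) := by
      rw [← mul_div_assoc 2 u, div_mul_div_comm, hq, mul_one]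
    have e2 : Real.sqrt 3 * ((1 + T ^ 2) * (Real.sqrt 3 / 2)) / 2 = (1 + u + u ^ 2) := by
      rw [hu]
      linear_combination (1 / 4 : ℝ) * h3
    rw [e1, e2]
    field_simp
    ring
end

section
/- Let U ⊆ ℝ × ℝ be an open set of points (t, x) with x ∈ (−π, π) such that φ(t,x) := arctan((2 tan(x/2) + 1)/√3) − (√3/2) t lies in (−π/2, π/2), and define s(x,t) = 2 arctan((√3 tan(φ(t,x)) − 1)/2) on U. Then s(x, 0) = x for all x with (0,x) ∈ U, and s satisfies the transport equation ∂ₜs + (sin(x) + 2) ∂ₓs = 0 on U. -/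
open Real

/-- On an open set `U` of points `(t,x)` with `x ∈ (−π, π)` and
`φ(t,x) = arctan((2 tan(x/2) + 1)/√3) − (√3/2) t ∈ (−π/2, π/2)`, the departure
point `s(x,t) = 2 arctan((√3 tan(φ(t,x)) − 1)/2)` satisfies `s(x,0) = x` and the
transport equation `∂ₜs + (sin(x) + 2) ∂ₓs = 0` on `U`. -/
theorem departure_point_transport_equation
    (U : Set (ℝ × ℝ)) (hU : IsOpen U)
    (φ : ℝ → ℝ → ℝ) (s : ℝ → ℝ → ℝ)
    (hφ : ∀ t x, φ t x = arctan ((2 * tan (x / 2) + 1) / Real.sqrt 3)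
      - (Real.sqrt 3 / 2) * t)
    (hUx : ∀ p ∈ U, p.2 ∈ Set.Ioo (-π) π)
    (hUφ : ∀ p ∈ U, φ p.1 p.2 ∈ Set.Ioo (-(π / 2)) (π / 2))
    (hs : ∀ t x, s x t = 2 * arctan ((Real.sqrt 3 * tan (φ t x) - 1) / 2)) :
    (∀ x, (0, x) ∈ U → s x 0 = x) ∧
    (∀ p ∈ U,
      deriv (fun τ => s p.2 τ) p.1
        + (Real.sin p.2 + 2) * deriv (fun y => s y p.1) p.2 = 0) := by
  have h3 : Real.sqrt 3 ^ 2 = 3 := Real.sq_sqrt (by norm_num)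
  have h3p : 0 < Real.sqrt 3 := Real.sqrt_pos.mpr (by norm_num)
  constructor
  · intro x hx
    have h1 := hUx _ hx
    simp only [Set.mem_Ioo] at h1
    rw [hs, hφ, mul_zero, sub_zero, Real.tan_arctan]
    have : (Real.sqrt 3 * ((2 * tan (x / 2) + 1) / Real.sqrt 3) - 1) / 2 = tan (x / 2) := by
      field_simp
      ring
    rw [this, Real.arctan_tan (by linarith) (by linarith)]
    ring
  · rintro ⟨t, x⟩ hp
    have h1 := hUx _ hp
    have h2 := hUφ _ hp
    simp only [Set.mem_Ioo] at h1 h2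
    have hc : 0 < Real.cos (x / 2) := Real.cos_pos_of_mem_Ioo ⟨by linarith, by linarith⟩
    have hcφ : Real.cos (φ t x) ≠ 0 := (Real.cos_pos_of_mem_Ioo ⟨h2.1, h2.2⟩).ne'
    have hG := ((((Real.hasDerivAt_tan hcφ).const_mul (Real.sqrt 3)).sub_const 1).div_const
      2).arctan.const_mul 2
    have hft : HasDerivAt (fun τ => φ τ x) (-(Real.sqrt 3 / 2)) t := by
      have := ((hasDerivAt_id t).const_mul (Real.sqrt 3 / 2)).const_sub
        (arctan ((2 * tan (x / 2) + 1) / Real.sqrt 3))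
      simp only [hφ]
      simpa using this
    have hsx : Real.sin x = 2 * Real.sin (x / 2) * Real.cos (x / 2) := by
      rw [← Real.sin_two_mul]
      congr 1
      ring
    have hpos : 0 < Real.sin x + 2 := by linarith [Real.neg_one_le_sin x]
    have hfx : HasDerivAt (fun y => φ t y) (Real.sqrt 3 / 2 / (Real.sin x + 2)) x := by
      have ht : HasDerivAt (fun y : ℝ => tan (y / 2)) (1 / Real.cos (x / 2) ^ 2 * (1 / 2)) x :=
        HasDerivAt.comp x (h₂ := tan) (h := fun y : ℝ => y / 2)
          (Real.hasDerivAt_tan hc.ne') ((hasDerivAt_id x).div_const 2)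
      have := ((((ht.const_mul 2).add_const 1).div_const (Real.sqrt 3)).arctan).sub_const
        (Real.sqrt 3 / 2 * t)
      simp only [hφ]
      refine this.congr_deriv ?_
      have hden : 1 + ((2 * tan (x / 2) + 1) / Real.sqrt 3) ^ 2
          = 2 * (Real.sin x + 2) / (3 * Real.cos (x / 2) ^ 2) := by
        rw [div_pow, h3, Real.tan_eq_sin_div_cos, hsx]
        field_simp
        linear_combination 4 * Real.sin_sq_add_cos_sq (x / 2)
      rw [hden]
      field_simp
      linear_combination -h3
    have e1 := HasDerivAt.comp t hG hft
    have e2 := HasDerivAt.comp x hG hfx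
    simp only [hs]
    have d1 := e1.deriv
    have d2 := e2.deriv
    simp only [Function.comp_def] at d1 d2
    rw [d1, d2]
    field_simp
    ring
end

section
/- Let U ⊆ ℝ × ℝ be an open set of points (t, x) with x ∈ (−π, π) such that φ(t,x) := arctan((2 tan(x/2) + 1)/√3) − (√3/2) t lies in (−π/2, π/2), and define s(x,t) = 2 arctan((√3 tan(φ(t,x)) − 1)/2) on U. Let q₀ : ℝ → ℝ be continuously differentiable. Then the function q(t,x) = q₀(s(x,t)) · (sin(s(x,t)) + 2)/(sin(x) + 2) satisfies the one-dimensional continuity equation ∂ₜq + (sin(x) + 2) ∂ₓq + cos(x) q = 0 on U, with q(0,x) = q₀(x) whenever (0,x) ∈ U. -/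
open Real

lemma aux_sin (w : ℝ) : Real.sin (2 * arctan w) = 2 * w / (1 + w ^ 2) := by
  have hc : Real.cos (arctan w) ≠ 0 := (Real.cos_arctan_pos w).ne'
  have h1 : Real.sin (arctan w) = w * Real.cos (arctan w) := by
    have := Real.tan_mul_cos hc
    rw [Real.tan_arctan] at this
    exact this.symm
  rw [Real.sin_two_mul, h1]
  have h2 := Real.cos_sq_arctan w
  calc _ = 2 * w * Real.cos (arctan w) ^ 2 := by ring
    _ = _ := by rw [h2]; ring

lemma aux_g (p : ℝ) (hp : Real.cos p ≠ 0) :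
    HasDerivAt (fun p => 2 * arctan ((Real.sqrt 3 * tan p - 1) / 2))
      (2 / Real.sqrt 3 * (Real.sin (2 * arctan ((Real.sqrt 3 * tan p - 1) / 2)) + 2)) p := by
  have h := (((((Real.hasDerivAt_tan hp).const_mul (Real.sqrt 3)).sub_const 1).div_const 2).arctan).const_mul 2
  refine HasDerivAt.congr_deriv h ?_; symm
  rw [aux_sin]
  have h3 : Real.sqrt 3 ^ 2 = 3 := Real.sq_sqrt (by norm_num)
  have h30 : Real.sqrt 3 ≠ 0 := by positivity
  have hT : 1 / Real.cos p ^ 2 = 1 + tan p ^ 2 := by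
    rw [← Real.inv_one_add_tan_sq hp]; simp
  rw [hT]
  generalize Real.tan p = T
  have hw : (1 + ((Real.sqrt 3 * T - 1) / 2) ^ 2) ≠ 0 := by positivity
  have key : 2 * ((Real.sqrt 3 * T - 1) / 2) / (1 + ((Real.sqrt 3 * T - 1) / 2) ^ 2) + 2
      = 3 / 2 * (1 + T ^ 2) / (1 + ((Real.sqrt 3 * T - 1) / 2) ^ 2) := by
    rw [div_add' _ _ _ hw]
    congr 1
    linear_combination (T ^ 2 / 2) * h3
  rw [key]
  generalize (1 + ((Real.sqrt 3 * T - 1) / 2) ^ 2) = W at hw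
  field_simp
  linear_combination -h3

lemma aux_phi (c x : ℝ) (hx : x ∈ Set.Ioo (-π) π) :
    HasDerivAt (fun x => arctan ((2 * tan (x / 2) + 1) / Real.sqrt 3) - c)
      (Real.sqrt 3 / 2 / (Real.sin x + 2)) x := by
  have hc : Real.cos (x / 2) ≠ 0 :=
    (Real.cos_pos_of_mem_Ioo ⟨by linarith [hx.1], by linarith [hx.2]⟩).ne'
  have ht : HasDerivAt (fun x : ℝ => tan (x / 2)) (1 / Real.cos (x / 2) ^ 2 * (1 / 2)) x :=
    HasDerivAt.comp x (Real.hasDerivAt_tan hc) ((hasDerivAt_id x).div_const 2)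
  have h := (((((ht.const_mul 2).add_const 1).div_const (Real.sqrt 3)).arctan).sub_const c)
  refine HasDerivAt.congr_deriv h ?_; symm
  have hxx : x = 2 * arctan (tan (x / 2)) := by
    rw [Real.arctan_tan (by linarith [hx.1]) (by linarith [hx.2])]; ring
  have hsin : Real.sin x = 2 * tan (x / 2) / (1 + tan (x / 2) ^ 2) := by
    rw [← aux_sin, ← hxx]
  have h3 : Real.sqrt 3 ^ 2 = 3 := Real.sq_sqrt (by norm_num)
  have h30 : Real.sqrt 3 ≠ 0 := by positivity
  have hT : 1 / Real.cos (x / 2) ^ 2 = 1 + tan (x / 2) ^ 2 := by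
    rw [← Real.inv_one_add_tan_sq hc]; simp
  rw [hT, hsin]
  generalize Real.tan (x / 2) = u
  have hu : (1 + u ^ 2) ≠ 0 := by positivity
  have hv : (1 + u + u ^ 2) ≠ 0 := by nlinarith [sq_nonneg (u + 1 / 2)]
  have e1 : 2 * u / (1 + u ^ 2) + 2 = 2 * (1 + u + u ^ 2) / (1 + u ^ 2) := by
    field_simp; ring
  have e2 : 1 + ((2 * u + 1) / Real.sqrt 3) ^ 2 = 4 / 3 * (1 + u + u ^ 2) := by
    rw [div_pow, h3]; ring
  rw [e1, e2]
  generalize (1 + u + u ^ 2) = V at hv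
  field_simp
  linear_combination 4 * h3

/-- With the departure point `s(x,t)` of the velocity field `v(x) = sin x + 2`
defined on an open set `U` as in the paper, and `q₀` continuously
differentiable, the function
`q(t,x) = q₀(s(x,t)) (sin(s(x,t)) + 2)/(sin x + 2)` satisfies the
one-dimensional continuity equation `∂ₜq + (sin x + 2) ∂ₓq + cos(x) q = 0` on
`U`, with `q(0,x) = q₀(x)` whenever `(0,x) ∈ U`. -/
theorem exact_solution_continuity_equation
    (U : Set (ℝ × ℝ)) (hU : IsOpen U)
    (φ : ℝ → ℝ → ℝ) (s : ℝ → ℝ → ℝ) (q₀ : ℝ → ℝ) (q : ℝ → ℝ → ℝ)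
    (hφ : ∀ t x, φ t x = arctan ((2 * tan (x / 2) + 1) / Real.sqrt 3)
      - (Real.sqrt 3 / 2) * t)
    (hUx : ∀ p ∈ U, p.2 ∈ Set.Ioo (-π) π)
    (hUφ : ∀ p ∈ U, φ p.1 p.2 ∈ Set.Ioo (-(π / 2)) (π / 2))
    (hs : ∀ t x, s x t = 2 * arctan ((Real.sqrt 3 * tan (φ t x) - 1) / 2))
    (hq₀ : ContDiff ℝ 1 q₀)
    (hq : ∀ t x, q t x = q₀ (s x t) * (Real.sin (s x t) + 2) / (Real.sin x + 2)) :
    (∀ p ∈ U,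
      deriv (fun τ => q τ p.2) p.1
        + (Real.sin p.2 + 2) * deriv (fun y => q p.1 y) p.2
        + Real.cos p.2 * q p.1 p.2 = 0) ∧
    (∀ x, (0, x) ∈ U → q 0 x = q₀ x) := by
  have h30 : Real.sqrt 3 ≠ 0 := by positivity
  have hX : ∀ x : ℝ, Real.sin x + 2 ≠ 0 := fun x => by linarith [Real.neg_one_le_sin x]
  constructor
  · rintro ⟨t, x⟩ hp
    have hx := hUx _ hp
    have hf := hUφ _ hp
    simp only at hx hf ⊢
    have hc : Real.cos (φ t x) ≠ 0 := (Real.cos_pos_of_mem_Ioo hf).ne'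
    have hg := aux_g (φ t x) hc
    rw [← hs] at hg
    have hφx : HasDerivAt (fun y => φ t y) (Real.sqrt 3 / 2 / (Real.sin x + 2)) x := by
      simp only [hφ]
      exact aux_phi _ x hx
    have hφt : HasDerivAt (fun τ => φ τ x) (-(Real.sqrt 3 / 2)) t := by
      simp only [hφ]
      simpa using ((hasDerivAt_id t).const_mul (Real.sqrt 3 / 2)).const_sub
        (arctan ((2 * tan (x / 2) + 1) / Real.sqrt 3))
    have hst : HasDerivAt (fun τ => s x τ) (-(Real.sin (s x t) + 2)) t := by
      have h := HasDerivAt.comp t hg hφt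
      have e : (fun τ => s x τ) =
          (fun p => 2 * arctan ((Real.sqrt 3 * tan p - 1) / 2)) ∘ (fun τ => φ τ x) := by
        funext τ; simp [hs]
      rw [e]
      refine HasDerivAt.congr_deriv h ?_; symm
      field_simp
    have hsx : HasDerivAt (fun y => s y t) ((Real.sin (s x t) + 2) / (Real.sin x + 2)) x := by
      have h := HasDerivAt.comp x hg hφx
      have e : (fun y => s y t) =
          (fun p => 2 * arctan ((Real.sqrt 3 * tan p - 1) / 2)) ∘ (fun y => φ t y) := by
        funext τ; simp [hs]
      rw [e]
      refine HasDerivAt.congr_deriv h ?_; symm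
      have := hX x
      field_simp
    obtain ⟨D, hD⟩ : ∃ D, HasDerivAt (fun z => q₀ z * (Real.sin z + 2)) D (s x t) :=
      ⟨_, ((hq₀.differentiable (by norm_num)) (s x t)).hasDerivAt.mul
        ((Real.hasDerivAt_sin _).add_const 2)⟩
    have hqt : HasDerivAt (fun τ => q τ x) (D * (-(Real.sin (s x t) + 2)) / (Real.sin x + 2)) t := by
      simp only [hq]
      exact (HasDerivAt.comp t hD hst).div_const (Real.sin x + 2)
    have hqx : HasDerivAt (fun y => q t y) ((D * ((Real.sin (s x t) + 2) / (Real.sin x + 2)) * (Real.sin x + 2)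
        - q₀ (s x t) * (Real.sin (s x t) + 2) * Real.cos x) / (Real.sin x + 2) ^ 2) x := by
      simp only [hq]
      exact (HasDerivAt.comp x hD hsx).div ((Real.hasDerivAt_sin x).add_const 2) (hX x)
    rw [hqt.deriv, hqx.deriv, hq]
    have := hX x
    field_simp
    ring
  · intro x hp
    have hx := hUx _ hp
    simp only at hx
    have e : s x 0 = x := by
      rw [hs, hφ, mul_zero, sub_zero, Real.tan_arctan, mul_div_cancel₀ _ h30]
      rw [show (2 * tan (x / 2) + 1 - 1) / 2 = tan (x / 2) by ring,
        Real.arctan_tan (by linarith [hx.1]) (by linarith [hx.2])]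
      ring
    rw [hq, e, mul_div_assoc, div_self (hX x), mul_one]
end

section
/- Let U ⊆ ℝ × ℝ be an open set of points (t, x) with x ∈ (−π, π) such that φ(t,x) := arctan((2 tan(x/2) + 1)/√3) − (√3/2) t lies in (−π/2, π/2), and define s(x,t) = 2 arctan((√3 tan(φ(t,x)) − 1)/2) on U. Let σ₀² : ℝ → ℝ be continuously differentiable. Then the function σ²(t,x) = σ₀²(s(x,t)) · ((sin(s(x,t)) + 2)/(sin(x) + 2))² satisfies the variance equation ∂ₜσ² + (sin(x) + 2) ∂ₓσ² + 2 cos(x) σ² = 0 on U, with σ²(0,x) = σ₀²(x) whenever (0,x) ∈ U. -/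
open Real

/-- With the departure point `s(x,t)` of the velocity field `v(x) = sin x + 2`
defined on an open set `U` as in the paper, and `σ₀²` continuously
differentiable, the function
`σ²(t,x) = σ₀²(s(x,t)) ((sin(s(x,t)) + 2)/(sin x + 2))²` satisfies the variance
equation `∂ₜσ² + (sin x + 2) ∂ₓσ² + 2 cos(x) σ² = 0` on `U`, with
`σ²(0,x) = σ₀²(x)` whenever `(0,x) ∈ U`. -/
theorem exact_solution_variance_equation
    (U : Set (ℝ × ℝ)) (hU : IsOpen U)
    (φ : ℝ → ℝ → ℝ) (s : ℝ → ℝ → ℝ) (σ₀sq : ℝ → ℝ) (σsq : ℝ → ℝ → ℝ)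
    (hφ : ∀ t x, φ t x = arctan ((2 * tan (x / 2) + 1) / Real.sqrt 3)
      - (Real.sqrt 3 / 2) * t)
    (hUx : ∀ p ∈ U, p.2 ∈ Set.Ioo (-π) π)
    (hUφ : ∀ p ∈ U, φ p.1 p.2 ∈ Set.Ioo (-(π / 2)) (π / 2))
    (hs : ∀ t x, s x t = 2 * arctan ((Real.sqrt 3 * tan (φ t x) - 1) / 2))
    (hσ₀ : ContDiff ℝ 1 σ₀sq)
    (hσ : ∀ t x, σsq t x
      = σ₀sq (s x t) * ((Real.sin (s x t) + 2) / (Real.sin x + 2)) ^ 2) :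
    (∀ p ∈ U,
      deriv (fun τ => σsq τ p.2) p.1
        + (Real.sin p.2 + 2) * deriv (fun y => σsq p.1 y) p.2
        + 2 * Real.cos p.2 * σsq p.1 p.2 = 0) ∧
    (∀ x, (0, x) ∈ U → σsq 0 x = σ₀sq x) := by
  constructor
  · rintro ⟨t, x⟩ hp
    have hx := hUx _ hp
    have hph := hUφ _ hp
    simp only at hx hph ⊢
    have hc : 0 < Real.cos (x / 2) :=
      Real.cos_pos_of_mem_Ioo ⟨by linarith [hx.1], by linarith [hx.2]⟩
    have hcφ : 0 < Real.cos (φ t x) := Real.cos_pos_of_mem_Ioo hph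
    have hv : ∀ y, 0 < Real.sin y + 2 := fun y => by linarith [Real.neg_one_le_sin y]
    have h3 : 0 < Real.sqrt 3 := by positivity
    have h33 : Real.sqrt 3 ^ 2 = 3 := Real.sq_sqrt (by norm_num)
    let G : ℝ → ℝ := fun u => 2 * arctan ((Real.sqrt 3 * tan u - 1) / 2)
    let F : ℝ → ℝ := fun u => σ₀sq (G u) * (Real.sin (G u) + 2) ^ 2
    have hσF : ∀ τ y, σsq τ y = F (φ τ y) / (Real.sin y + 2) ^ 2 := by
      intro τ y
      rw [hσ, hs]
      simp only [F, G]
      rw [div_pow, mul_div_assoc]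
    have hG : DifferentiableAt ℝ G (φ t x) := by
      have h1 : DifferentiableAt ℝ tan (φ t x) := Real.differentiableAt_tan.2 hcφ.ne'
      have h2 : DifferentiableAt ℝ (fun u => (Real.sqrt 3 * tan u - 1) / 2) (φ t x) :=
        ((h1.const_mul _).sub_const _).div_const _
      exact h2.arctan.const_mul 2
    have hF : DifferentiableAt ℝ F (φ t x) := by
      have h0 : DifferentiableAt ℝ σ₀sq (G (φ t x)) := (hσ₀.differentiable (by norm_num)) _
      have h1 : DifferentiableAt ℝ (fun u => σ₀sq (G u)) (φ t x) := h0.comp _ hG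
      exact h1.mul ((hG.sin.add_const 2).pow 2)
    obtain ⟨A, hA⟩ : ∃ A, HasDerivAt F A (φ t x) := ⟨_, hF.hasDerivAt⟩
    have hφt : HasDerivAt (fun τ => φ τ x) (-(Real.sqrt 3 / 2)) t := by
      simp only [hφ]
      simpa using ((hasDerivAt_id t).const_mul (Real.sqrt 3 / 2)).const_sub
        (arctan ((2 * tan (x / 2) + 1) / Real.sqrt 3))
    have hφx : HasDerivAt (fun y => φ t y) (Real.sqrt 3 / 2 / (Real.sin x + 2)) x := by
      simp only [hφ]
      have h1 : HasDerivAt (fun y : ℝ => y / 2) (1 / 2) x := (hasDerivAt_id x).div_const 2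
      have h2 : HasDerivAt (fun y : ℝ => tan (y / 2)) (1 / Real.cos (x / 2) ^ 2 * (1 / 2)) x :=
        HasDerivAt.comp x (h₂ := tan) (h := fun y : ℝ => y / 2) (Real.hasDerivAt_tan hc.ne') h1
      have h4 := ((((h2.const_mul 2).add_const 1).div_const (Real.sqrt 3)).arctan).sub_const
        (Real.sqrt 3 / 2 * t)
      refine h4.congr_deriv ?_
      symm
      have e : Real.sin x = 2 * Real.sin (x / 2) * Real.cos (x / 2) := by
        rw [← Real.sin_two_mul]; ring_nf
      have hvx := hv x
      rw [Real.tan_eq_sin_div_cos]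
      have hsc := Real.sin_sq_add_cos_sq (x / 2)
      rw [e] at hvx ⊢
      generalize Real.sin (x / 2) = S at *
      generalize Real.cos (x / 2) = c at *
      generalize Real.sqrt 3 = r at *
      have hd : 1 + ((2 * (S / c) + 1) / r) ^ 2 = 2 * (2 * S * c + 2) / (3 * c ^ 2) := by
        rw [div_pow, h33]
        field_simp
        linear_combination 4 * hsc
      rw [hd]
      clear hd e
      generalize 2 * S * c + 2 = w at *
      field_simp
      linear_combination h33
    have hst : HasDerivAt (fun τ => σsq τ x)
        (A * (-(Real.sqrt 3 / 2)) / (Real.sin x + 2) ^ 2) t := by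
      simp only [hσF]
      exact (HasDerivAt.comp t (h₂ := F) (h := fun τ => φ τ x) hA hφt).div_const _
    have hsx : HasDerivAt (fun y => σsq t y)
        ((A * (Real.sqrt 3 / 2 / (Real.sin x + 2)) * (Real.sin x + 2) ^ 2
          - F (φ t x) * (2 * (Real.sin x + 2) * Real.cos x)) / ((Real.sin x + 2) ^ 2) ^ 2) x := by
      simp only [hσF]
      have h1 := HasDerivAt.comp x (h₂ := F) (h := fun y => φ t y) hA hφx
      have h2 : HasDerivAt (fun y => (Real.sin y + 2) ^ 2)
          (2 * (Real.sin x + 2) * Real.cos x) x := by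
        exact (((Real.hasDerivAt_sin x).add_const 2).pow 2).congr_deriv (by norm_num)
      exact h1.div h2 (pow_pos (hv x) 2).ne'
    rw [hst.deriv, hsx.deriv, hσF]
    have := (hv x).ne'
    field_simp
    ring
  · intro x hp
    have hx := hUx _ hp
    simp only at hx
    have h3 : Real.sqrt 3 ≠ 0 := by positivity
    have hsx : s x 0 = x := by
      rw [hs, hφ, mul_zero, sub_zero, Real.tan_arctan, mul_div_cancel₀ _ h3,
        add_sub_cancel_right, mul_div_cancel_left₀ _ (two_ne_zero),
        Real.arctan_tan (by linarith [hx.1]) (by linarith [hx.2])]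
      ring
    have hv : Real.sin x + 2 ≠ 0 := by linarith [Real.neg_one_le_sin x]
    rw [hσ, hsx, div_self hv]
    ring
end
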